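/- Let G = (V,E) be an infinite, simple, locally finite, connected graph, let (v_k)_{k≥0} be an enumeration of V with deg(v_k) ≤ deg(v_{k+1}) for all k, and let s ∈ (0,1), p ∈ (0,1) and λ > 0 satisfy s^p ≤ 1 − p and λ^p ≤ s/(1−p). Let n ∈ ℕ be such that deg(v_k) ≥ (k+1)/s for all k ≥ n, and define u : V → ℝ by u(v) = 1 − (deg(v) + λ)^{−p}. Then for every vertex v ∈ V not contained in K = ⋃_{k=0}^{n−1} B_1(v_k), one has Σ_{w∼v} (u(v) − u(w)) + λ·u(v) ≤ 0. -/

import Mathlib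

/-- Among the finite sets of naturals of given cardinality, an initial segment maximizes the sum
of an antitone function. -/
theorem Finset.sum_le_sum_range_card_of_antitone {f : ℕ → ℝ} (hf : Antitone f) (S : Finset ℕ) :
    ∑ k ∈ S, f k ≤ ∑ k ∈ Finset.range S.card, f k := by
  induction S using Finset.induction_on_max with
  | empty => simp
  | insert a S hS ih =>
    have ha : a ∉ S := fun h => lt_irrefl a (hS a h)
    have hcard : S.card ≤ a := by
      simpa using Finset.card_le_card (fun x hx => Finset.mem_range.2 (hS x hx) : S ⊆ Finset.range a)
    rw [Finset.sum_insert ha, Finset.card_insert_of_notMem ha, Finset.sum_range_succ, add_comm]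
    exact add_le_add ih (hf hcard)

/-- The discrete counterpart of `(1 - p) * x ^ (-p)` being the derivative of `x ^ (1 - p)`. -/
theorem Real.mul_rpow_neg_le_rpow_sub_rpow {p x : ℝ} (hp0 : 0 ≤ p) (hp1 : p ≤ 1) (hx : 0 ≤ x) :
    (1 - p) * (x + 1) ^ (-p) ≤ (x + 1) ^ (1 - p) - x ^ (1 - p) := by
  have hx1 : 0 < x + 1 := by linarith
  have hinv : (x + 1)⁻¹ ≤ 1 := inv_le_one_of_one_le₀ (by linarith)
  have hbern := rpow_one_add_le_one_add_mul_self (s := -(x + 1)⁻¹) (by linarith)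
    (sub_nonneg.2 hp1) (by linarith : 1 - p ≤ 1)
  have hxeq : x = (x + 1) * (1 + -(x + 1)⁻¹) := by field_simp; ring
  have hpow : x ^ (1 - p) = (x + 1) ^ (1 - p) * (1 + -(x + 1)⁻¹) ^ (1 - p) := by
    rw [← Real.mul_rpow hx1.le (by linarith), ← hxeq]
  have hneg : (x + 1) ^ (-p) = (x + 1) ^ (1 - p) * (x + 1)⁻¹ := by
    rw [← Real.rpow_neg_one, ← Real.rpow_add hx1]; ring_nf
  have := mul_le_mul_of_nonneg_left hbern (Real.rpow_nonneg hx1.le (1 - p))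
  rw [hpow, hneg]
  linarith

/-- The discrete counterpart of integrating `(x + c) ^ (-p)` over `[0, d]`. -/
theorem Real.mul_sum_range_rpow_neg_le {p c : ℝ} (hp0 : 0 ≤ p) (hp1 : p ≤ 1) (hc : 0 ≤ c)
    (d : ℕ) :
    (1 - p) * ∑ k ∈ Finset.range d, ((k : ℝ) + 1 + c) ^ (-p) ≤
      ((d : ℝ) + c) ^ (1 - p) - c ^ (1 - p) := by
  have htel := Finset.sum_range_sub (fun k : ℕ => ((k : ℝ) + c) ^ (1 - p)) d
  simp only [Nat.cast_zero, zero_add] at htel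
  rw [← htel, Finset.mul_sum]
  refine Finset.sum_le_sum fun k _ => ?_
  have := Real.mul_rpow_neg_le_rpow_sub_rpow hp0 hp1 (by positivity : 0 ≤ (k : ℝ) + c)
  push_cast
  rwa [add_right_comm] at this


/-- Let `G` be an infinite, simple, locally finite, connected graph,
`e` an enumeration with nondecreasing degrees, `s, p ∈ (0,1)`, `λ > 0` with
`s^p ≤ 1 − p` and `λ^p ≤ s/(1−p)`, and `n` such that `deg (e k) ≥ (k+1)/s` for all
`k ≥ n`.  Define `u(v) = 1 − (deg v + λ)^{−p}`.  Then for every vertex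
`v ∉ K = ⋃_{k<n} B_1(e k)` one has `Σ_{w∼v} (u(v) − u(w)) + λ·u(v) ≤ 0`. -/
theorem explicit_subharmonic_function
    {V : Type*} (G : SimpleGraph V) [Infinite V]
    [∀ v : V, Fintype (G.neighborSet v)] (hconn : G.Connected)
    (e : ℕ → V) (he : Function.Bijective e)
    (hmono : ∀ k : ℕ, G.degree (e k) ≤ G.degree (e (k + 1)))
    (s p lam : ℝ) (hs0 : 0 < s) (hs1 : s < 1) (hp0 : 0 < p) (hp1 : p < 1)
    (hlam : 0 < lam)
    (hsp : s ^ p ≤ 1 - p) (hlamp : lam ^ p ≤ s / (1 - p))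
    (n : ℕ)
    (hdeg : ∀ k ≥ n, ((k : ℝ) + 1) / s ≤ (G.degree (e k) : ℝ))
    (u : V → ℝ) (hu : ∀ w : V, u w = 1 - ((G.degree w : ℝ) + lam) ^ (-p))
    (v : V)
    (hv : v ∉ ⋃ k ∈ Finset.range n, (({e k} : Set V) ∪ G.neighborSet (e k))) :
    (∑ w ∈ G.neighborFinset v, (u v - u w)) + lam * u v ≤ 0 := by
  obtain ⟨hn, hpq⟩ : (∀ k, G.Adj v (e k) → n ≤ k) ∧ 0 < 1 - p := by
    refine ⟨fun k hk => ?_, by linarith⟩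
    by_contra! hkn
    exact hv (Set.mem_biUnion (Finset.mem_coe.2 (Finset.mem_range.2 hkn)) (Or.inr hk.symm))
  set d := G.degree v with hd
  set f : ℕ → ℝ := fun k => (((k : ℝ) + 1) / s + lam) ^ (-p) with hf
  have hfanti : Antitone f := fun a b hab =>
    Real.rpow_le_rpow_of_nonpos (by positivity) (by gcongr) (by linarith)
  let E := Equiv.ofBijective e he
  have hsum : ∑ w ∈ G.neighborFinset v, ((G.degree w : ℝ) + lam) ^ (-p) ≤
      ∑ k ∈ Finset.range d, f k := by
    calc ∑ w ∈ G.neighborFinset v, ((G.degree w : ℝ) + lam) ^ (-p)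
        ≤ ∑ w ∈ G.neighborFinset v, f (E.symm w) := by
          refine Finset.sum_le_sum fun w hw => ?_
          have hew : e (E.symm w) = w := E.apply_symm_apply w
          have hadj : G.Adj v (e (E.symm w)) := by
            rw [hew]; exact (G.mem_neighborFinset v w).1 hw
          have hle := hdeg _ (hn _ hadj)
          rw [hew] at hle
          exact Real.rpow_le_rpow_of_nonpos (by positivity) (by linarith) (by linarith)
      _ = ∑ k ∈ (G.neighborFinset v).map E.symm.toEmbedding, f k := by simp
      _ ≤ ∑ k ∈ Finset.range d, f k := by
          simpa [hd] using Finset.sum_le_sum_range_card_of_antitone hfanti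
            ((G.neighborFinset v).map E.symm.toEmbedding)
  have hscale : ∑ k ∈ Finset.range d, f k =
      s ^ p * ∑ k ∈ Finset.range d, ((k : ℝ) + 1 + s * lam) ^ (-p) := by
    rw [Finset.mul_sum]
    refine Finset.sum_congr rfl fun k _ => ?_
    have hfrac : ((k : ℝ) + 1) / s + lam = ((k : ℝ) + 1 + s * lam) / s := by field_simp
    simp only [hf]
    rw [hfrac, Real.div_rpow (by positivity) hs0.le, Real.rpow_neg hs0.le, div_inv_eq_mul, mul_comm]
  have hbound := Real.mul_sum_range_rpow_neg_le hp0.le hp1.le (by positivity : 0 ≤ s * lam) d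
  have hmain : ∑ k ∈ Finset.range d, f k ≤ ((d : ℝ) + lam) ^ (1 - p) - lam := by
    have hlow : (1 - p) * lam ≤ s ^ p * (s * lam) ^ (1 - p) := by
      have hs : s ^ p * s ^ (1 - p) = s := by rw [← Real.rpow_add hs0]; simp
      have hl : lam ^ p * lam ^ (1 - p) = lam := by rw [← Real.rpow_add hlam]; simp
      rw [Real.mul_rpow hs0.le hlam.le, ← mul_assoc, hs]
      rw [le_div_iff₀ hpq] at hlamp
      have := mul_le_mul_of_nonneg_right hlamp (Real.rpow_nonneg hlam.le (1 - p))
      calc (1 - p) * lam = lam ^ p * (1 - p) * lam ^ (1 - p) := by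
            rw [mul_right_comm, hl, mul_comm]
        _ ≤ s * lam ^ (1 - p) := this
    have hup : s ^ p * ((d : ℝ) + s * lam) ^ (1 - p) ≤ (1 - p) * ((d : ℝ) + lam) ^ (1 - p) := by
      gcongr
      nlinarith
    rw [hscale]
    refine le_of_mul_le_mul_left ?_ hpq
    have := mul_le_mul_of_nonneg_left hbound (Real.rpow_nonneg hs0.le p)
    linarith
  have hpow : ((d : ℝ) + lam) ^ (1 - p) = ((d : ℝ) + lam) * ((d : ℝ) + lam) ^ (-p) := by
    rw [sub_eq_add_neg, Real.rpow_add (by positivity), Real.rpow_one]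
  have hlap : ∑ w ∈ G.neighborFinset v, (u v - u w) =
      ∑ w ∈ G.neighborFinset v, ((G.degree w : ℝ) + lam) ^ (-p) - d * ((d : ℝ) + lam) ^ (-p) := by
    simp only [hu, sub_sub_sub_cancel_left, Finset.sum_sub_distrib, Finset.sum_const,
      G.card_neighborFinset_eq_degree, nsmul_eq_mul, hd]
  rw [hlap, hu v]
  linarith
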